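/- arXiv:2102.11136 — 2 statements merged into one kernel-verified Lean document; each statement's English description precedes it below -/
import Mathlib

section
/- Let A, B, C be nonempty finite types and ψ : A × B × C → ℂ a unit vector, with pure state P = |ψ⟩⟨ψ| on A × B × C and marginals ψ^{AC} = Tr_B P, ψ^{A} = Tr_{BC} P, ψ^{B} = Tr_{AC} P. Then the quantum conditional entropy H_ψ(C|A) := H(ψ^{AC}) − H(ψ^{A}) satisfies H_ψ(C|A) = H(ψ^{B}) − H(ψ^{A}); equivalently, H(ψ^{AC}) = H(ψ^{B}). -/
open Matrix BigOperators Finset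
open scoped ComplexOrder

noncomputable section

/-- Rank-one projector `|v⟩⟨v|`. -/
def outer {I : Type*} (v : I → ℂ) : Matrix I I ℂ :=
  Matrix.of fun i j => v i * star (v j)

open scoped Classical in
/-- Von Neumann entropy of a (Hermitian) matrix: `∑ i, -λ i * log (λ i)` over
its eigenvalues (junk value `0` for non-Hermitian matrices). -/
def vN {I : Type*} [Fintype I] [DecidableEq I] (ρ : Matrix I I ℂ) : ℝ :=
  if h : ρ.IsHermitian then ∑ i, Real.negMulLog (h.eigenvalues i) else 0

/-- Partial trace over `B`: the marginal on `A × C`. -/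
def trB {A B C : Type*} [Fintype B] (M : Matrix (A × B × C) (A × B × C) ℂ) :
    Matrix (A × C) (A × C) ℂ :=
  Matrix.of fun p q => ∑ b, M (p.1, b, p.2) (q.1, b, q.2)

/-- Partial trace over `A`: the marginal on `B × C`. -/
def trA {A B C : Type*} [Fintype A] (M : Matrix (A × B × C) (A × B × C) ℂ) :
    Matrix (B × C) (B × C) ℂ :=
  Matrix.of fun p q => ∑ a, M (a, p) (a, q)

/-- Partial trace over `B` and `C`: the marginal on `A`. -/
def trBC {A B C : Type*} [Fintype B] [Fintype C]
    (M : Matrix (A × B × C) (A × B × C) ℂ) : Matrix A A ℂ :=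
  Matrix.of fun a a' => ∑ b, ∑ c, M (a, b, c) (a', b, c)

/-- Partial trace over `A` and `C`: the marginal on `B`. -/
def trAC {A B C : Type*} [Fintype A] [Fintype C]
    (M : Matrix (A × B × C) (A × B × C) ℂ) : Matrix B B ℂ :=
  Matrix.of fun b b' => ∑ a, ∑ c, M (a, b, c) (a, b', c)

/-- The von Neumann entropy of a Hermitian matrix as a sum over the roots of its characteristic
polynomial. -/
theorem vN_eq_sum_roots_charpoly {I : Type*} [Fintype I] [DecidableEq I] {ρ : Matrix I I ℂ}
    (h : ρ.IsHermitian) :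
    vN ρ = (ρ.charpoly.roots.map fun z : ℂ => Real.negMulLog z.re).sum := by
  rw [vN, dif_pos h, h.roots_charpoly_eq_eigenvalues, Multiset.map_map]
  rfl

/-- Factors of `X` do not contribute to the entropy sum over the roots of a polynomial. -/
theorem sum_negMulLog_roots_X_pow_mul {p : Polynomial ℂ} (hp : p ≠ 0) (k : ℕ) :
    ((Polynomial.X ^ k * p).roots.map fun z : ℂ => Real.negMulLog z.re).sum =
      (p.roots.map fun z : ℂ => Real.negMulLog z.re).sum := by
  rw [Polynomial.roots_mul (mul_ne_zero (pow_ne_zero _ Polynomial.X_ne_zero) hp),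
    Polynomial.roots_X_pow]
  simp [Multiset.map_nsmul, Multiset.sum_nsmul]

/-- `M * Mᴴ` and `Mᴴ * M` have the same von Neumann entropy. -/
theorem vN_mul_conjTranspose_self {I J : Type*} [Fintype I] [DecidableEq I] [Fintype J]
    [DecidableEq J] (M : Matrix I J ℂ) : vN (M * Mᴴ) = vN (Mᴴ * M) := by
  rw [vN_eq_sum_roots_charpoly (isHermitian_mul_conjTranspose_self M),
    vN_eq_sum_roots_charpoly (isHermitian_conjTranspose_mul_self M),
    ← sum_negMulLog_roots_X_pow_mul (charpoly_monic (M * Mᴴ)).ne_zero (Fintype.card J),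
    charpoly_mul_comm', sum_negMulLog_roots_X_pow_mul (charpoly_monic _).ne_zero]

/-- The von Neumann entropy of a Hermitian matrix is invariant under transposition. -/
theorem vN_transpose {I : Type*} [Fintype I] [DecidableEq I] {ρ : Matrix I I ℂ}
    (h : ρ.IsHermitian) : vN ρᵀ = vN ρ := by
  rw [vN_eq_sum_roots_charpoly h, vN_eq_sum_roots_charpoly h.transpose, charpoly_transpose]

/-- The marginals of a rank-one matrix on `A × C` and on `B` have the same entropy. -/
theorem vN_trB_outer {A B C : Type*} [Fintype A] [Fintype B] [Fintype C]
    [DecidableEq A] [DecidableEq B] [DecidableEq C] (ψ : A × B × C → ℂ) :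
    vN (trB (outer ψ)) = vN (trAC (outer ψ)) := by
  let M : Matrix (A × C) B ℂ := Matrix.of fun p b => ψ (p.1, b, p.2)
  have hAC : trB (outer ψ) = M * Mᴴ := by
    ext p q
    simp [trB, outer, M, Matrix.mul_apply]
  have hB : trAC (outer ψ) = (Mᴴ * M)ᵀ := by
    ext b b'
    simp [trAC, outer, M, Matrix.mul_apply, Fintype.sum_prod_type, mul_comm]
  rw [hAC, hB, vN_transpose (isHermitian_conjTranspose_mul_self M), vN_mul_conjTranspose_self]

/-- For a tripartite pure state `ψ`, the conditional entropy
`H_ψ(C|A) = H(ψ^{AC}) - H(ψ^A)` equals `H(ψ^B) - H(ψ^A)`; equivalently,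
`H(ψ^{AC}) = H(ψ^B)`. -/
theorem conditional_entropy_pure {A B C : Type*}
    [Fintype A] [Fintype B] [Fintype C]
    [DecidableEq A] [DecidableEq B] [DecidableEq C]
    [Nonempty A] [Nonempty B] [Nonempty C]
    (ψ : A × B × C → ℂ) (hψ : ∑ i, ‖ψ i‖ ^ 2 = 1) :
    vN (trB (outer ψ)) - vN (trBC (outer ψ))
        = vN (trAC (outer ψ)) - vN (trBC (outer ψ)) ∧
      vN (trB (outer ψ)) = vN (trAC (outer ψ)) := by
  exact ⟨by rw [vN_trB_outer], vN_trB_outer ψ⟩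
end
end

section
/- Let A, B, A', B' be nonempty finite types, ρ a density matrix on A × B, and χ : A' × B' → ℂ a unit vector. Consider the joint state ρ' = ρ ⊗ₖ |χ⟩⟨χ| on (A × B) × (A' × B'), regarded as a bipartite state between the parties AA' and BB'. Then the conditional entropy of ρ' satisfies H(ρ') − H(Tr_{AA'} ρ') = (H(ρ) − H(Tr_A ρ)) − H(Tr_{A'} |χ⟩⟨χ|); that is, appending a shared pure state χ with entanglement entropy E = H(Tr_{A'} |χ⟩⟨χ|) lowers the conditional entropy H(A|B) by exactly E. In particular, if H(ρ) − H(Tr_A ρ) = H(Tr_{A'} |χ⟩⟨χ|), then the conditional entropy of ρ' is zero. -/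
open Matrix BigOperators Finset Kronecker
open scoped ComplexOrder

noncomputable section

/-- Partial trace over the first factor of a bipartite index. -/
def trFst {A B : Type*} [Fintype A] (M : Matrix (A × B) (A × B) ℂ) :
    Matrix B B ℂ :=
  Matrix.of fun b b' => ∑ a, M (a, b) (a, b')

/-- Partial trace over `A` and `A'` of a state on `(A × B) × (A' × B')`,
regarded as a bipartite state between the parties `AA'` and `BB'`. -/
def trAA' {A B A' B' : Type*} [Fintype A] [Fintype A']
    (M : Matrix ((A × B) × (A' × B')) ((A × B) × (A' × B')) ℂ) :
    Matrix (B × B') (B × B') ℂ :=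
  Matrix.of fun p q => ∑ a : A, ∑ a' : A',
    M ((a, p.1), (a', p.2)) ((a, q.1), (a', q.2))

/-- The entropy of a Hermitian matrix can be read off from a factorization of its
characteristic polynomial. -/
lemma vN_eq_sum_of_charpoly_eq {I J : Type*} [Fintype I] [DecidableEq I] [Fintype J]
    {M : Matrix I I ℂ} (hM : M.IsHermitian) (d : J → ℝ)
    (h : M.charpoly = ∏ j, (Polynomial.X - Polynomial.C (d j : ℂ))) :
    vN M = ∑ j, Real.negMulLog (d j) := by
  have key : Multiset.map (fun i => (hM.eigenvalues i : ℂ)) univ.val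
      = Multiset.map (fun j => (d j : ℂ)) univ.val := by
    have h1 := hM.roots_charpoly_eq_eigenvalues
    have h2 : M.charpoly = ((Multiset.map (fun j => (d j : ℂ)) univ.val).map
        fun a => Polynomial.X - Polynomial.C a).prod := by
      rw [h, Multiset.map_map]
      rfl
    rw [h2, Polynomial.roots_multiset_prod_X_sub_C] at h1
    exact h1.symm
  have := congrArg (fun s => (s.map (fun z : ℂ => Real.negMulLog z.re)).sum) key
  simpa [vN, hM, Multiset.map_map, Function.comp_def] using this

lemma charpoly_kronecker {I J : Type*} [Fintype I] [DecidableEq I] [Fintype J] [DecidableEq J]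
    {M : Matrix I I ℂ} {N : Matrix J J ℂ} (hM : M.IsHermitian) (hN : N.IsHermitian) :
    (M ⊗ₖ N).charpoly = ∏ p : I × J,
      (Polynomial.X - Polynomial.C ((hM.eigenvalues p.1 * hN.eigenvalues p.2 : ℝ) : ℂ)) := by
  conv_lhs =>
    rw [hM.spectral_theorem, hN.spectral_theorem, Unitary.conjStarAlgAut_apply,
      Unitary.conjStarAlgAut_apply, mul_kronecker_mul, mul_kronecker_mul, charpoly_mul_comm,
      ← mul_assoc, ← mul_kronecker_mul]
  simp [charpoly_diagonal, diagonal_kronecker_diagonal]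

/-- The entropy is additive on tensor products, up to the weights given by the traces. -/
lemma vN_kronecker {I J : Type*} [Fintype I] [DecidableEq I] [Fintype J] [DecidableEq J]
    {M : Matrix I I ℂ} {N : Matrix J J ℂ} (hM : M.IsHermitian) (hN : N.IsHermitian) :
    vN (M ⊗ₖ N) = N.trace.re * vN M + M.trace.re * vN N := by
  have hMN : (M ⊗ₖ N).IsHermitian := by
    rw [IsHermitian, conjTranspose_kronecker, hM.eq, hN.eq]
  rw [vN_eq_sum_of_charpoly_eq hMN _ (charpoly_kronecker hM hN), Fintype.sum_prod_type,
    hM.trace_eq_sum_eigenvalues, hN.trace_eq_sum_eigenvalues]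
  simp only [vN, hM, hN, dif_pos, Real.negMulLog_mul, Finset.sum_add_distrib, Complex.re_sum,
    Complex.coe_algebraMap, Complex.ofReal_re, Finset.sum_mul_sum]
  rw [Finset.sum_comm]

lemma isHermitian_outer {I : Type*} (v : I → ℂ) : (outer v).IsHermitian := by
  ext i j
  simp [outer, mul_comm]

lemma trace_outer {I : Type*} [Fintype I] (v : I → ℂ) :
    (outer v).trace = ((∑ i, ‖v i‖ ^ 2 : ℝ) : ℂ) := by
  simp [outer, Matrix.trace, Complex.mul_conj']

lemma outer_mul_self {I : Type*} [Fintype I] (v : I → ℂ) :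
    outer v * outer v = (outer v).trace • outer v := by
  ext i j
  simp only [outer, mul_apply, of_apply, Matrix.trace, diag_apply, Matrix.smul_apply, smul_eq_mul,
    Finset.sum_mul]
  exact Finset.sum_congr rfl fun k _ => by ring

lemma vN_eq_zero_of_mul_self_eq {I : Type*} [Fintype I] [DecidableEq I] {M : Matrix I I ℂ}
    (hM : M.IsHermitian) (h : M * M = M) : vN M = 0 := by
  rw [vN, dif_pos hM]
  refine Finset.sum_eq_zero fun i _ => ?_
  have hi := IsIdempotentElem.spectrum_subset ℝ (p := M) h (hM.eigenvalues_mem_spectrum_real i)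
  rcases hi with hi | hi <;> simp_all

lemma isHermitian_trFst {A B : Type*} [Fintype A] {M : Matrix (A × B) (A × B) ℂ}
    (hM : M.IsHermitian) : (trFst M).IsHermitian := by
  ext b b'
  simp only [trFst, conjTranspose_apply, of_apply, star_sum]
  exact Finset.sum_congr rfl fun a _ => hM.apply _ _

lemma trace_trFst {A B : Type*} [Fintype A] [Fintype B] (M : Matrix (A × B) (A × B) ℂ) :
    (trFst M).trace = M.trace := by
  simp only [trFst, Matrix.trace, diag_apply, of_apply, Fintype.sum_prod_type]
  exact Finset.sum_comm

lemma trAA'_kronecker {A B A' B' : Type*} [Fintype A] [Fintype A']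
    (M : Matrix (A × B) (A × B) ℂ) (N : Matrix (A' × B') (A' × B') ℂ) :
    trAA' (M ⊗ₖ N) = trFst M ⊗ₖ trFst N := by
  ext p q
  simp [trAA', trFst, kroneckerMap_apply, Finset.sum_mul_sum]

/-- Appending a shared pure state `χ` with entanglement entropy
`E = H(Tr_{A'} |χ⟩⟨χ|)` lowers the conditional entropy `H(A|B)` by exactly `E`:
the joint state `ρ' = ρ ⊗ |χ⟩⟨χ|`, regarded as bipartite between `AA'` and
`BB'`, satisfies `H(ρ') - H(Tr_{AA'} ρ') = (H(ρ) - H(Tr_A ρ)) - E`. In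
particular, if `H(ρ) - H(Tr_A ρ) = E`, the conditional entropy of `ρ'`
vanishes. -/
theorem conditional_entropy_append_pure {A B A' B' : Type*}
    [Fintype A] [Fintype B] [Fintype A'] [Fintype B']
    [DecidableEq A] [DecidableEq B] [DecidableEq A'] [DecidableEq B']
    [Nonempty A] [Nonempty B] [Nonempty A'] [Nonempty B']
    (ρ : Matrix (A × B) (A × B) ℂ) (hρ : ρ.PosSemidef) (hρtr : ρ.trace = 1)
    (χ : A' × B' → ℂ) (hχ : ∑ i, ‖χ i‖ ^ 2 = 1) :
    vN (ρ ⊗ₖ outer χ) - vN (trAA' (ρ ⊗ₖ outer χ))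
        = (vN ρ - vN (trFst ρ)) - vN (trFst (outer χ)) ∧
      (vN ρ - vN (trFst ρ) = vN (trFst (outer χ)) →
        vN (ρ ⊗ₖ outer χ) - vN (trAA' (ρ ⊗ₖ outer χ)) = 0) := by
  have hO := isHermitian_outer χ
  have hOtr : (outer χ).trace = 1 := by rw [trace_outer, hχ, Complex.ofReal_one]
  have hpure : vN (outer χ) = 0 :=
    vN_eq_zero_of_mul_self_eq hO (by rw [outer_mul_self, hOtr, one_smul])
  have main : vN (ρ ⊗ₖ outer χ) - vN (trAA' (ρ ⊗ₖ outer χ))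
      = (vN ρ - vN (trFst ρ)) - vN (trFst (outer χ)) := by
    rw [trAA'_kronecker, vN_kronecker hρ.isHermitian hO,
      vN_kronecker (isHermitian_trFst hρ.isHermitian) (isHermitian_trFst hO),
      trace_trFst, trace_trFst, hρtr, hOtr, hpure, Complex.one_re]
    ring
  exact ⟨main, fun h => by rw [main, h, sub_self]⟩
end
end
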